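/- Let n ≥ 1, let V_k and V_v be real symmetric positive semidefinite n×n matrices, let c_k, c_v ∈ ℝⁿ and α_k, α_v > 0, and suppose there exist w_k, w_v ∈ ℝⁿ with V_k w_k = c_k and V_v w_v = c_v. Define T₁ = (1/(2α_k))(c_k · w_k) + (1/(2α_v))(c_v · w_v). Then the real symmetric (2+2n)×(2+2n) block matrix whose leading 2×2 block is [[2T₁, −2T₁], [−2T₁, 2T₁]], whose first two rows continue with the row vectors [−c_kᵀ, c_vᵀ] and [c_kᵀ, −c_vᵀ], whose first two columns continue with the column vectors [−c_k; c_v] and [c_k; −c_v], and whose trailing 2n×2n block is diag(α_k V_k, α_v V_v), is positive semidefinite. -/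

import Mathlib

open Matrix

/-- Completing the square for a positive semidefinite quadratic form, where the linear term lies
in the range of the matrix. -/
theorem Matrix.PosSemidef.complete_square_nonneg {ι : Type*} [Fintype ι] {V : Matrix ι ι ℝ}
    (hV : V.PosSemidef) {c w : ι → ℝ} (hw : V *ᵥ w = c) {α : ℝ} (hα : 0 < α) (d : ℝ) (y : ι → ℝ) :
    0 ≤ d ^ 2 * ((1 / α) * (c ⬝ᵥ w)) - 2 * d * (c ⬝ᵥ y) + α * (y ⬝ᵥ V *ᵥ y) := by
  have h := hV.dotProduct_mulVec_nonneg (α • y - d • w)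
  have hs : w ⬝ᵥ V *ᵥ y = c ⬝ᵥ y := by
    have hT : Vᵀ = V := by simpa using hV.isHermitian.eq
    rw [dotProduct_mulVec, ← mulVec_transpose, hT, hw]
  simp only [star_trivial, mulVec_sub, mulVec_smul, sub_dotProduct, dotProduct_sub,
    smul_dotProduct, dotProduct_smul, smul_eq_mul, hw, hs] at h
  rw [dotProduct_comm y c, dotProduct_comm w c] at h
  have h' := mul_nonneg (one_div_pos.mpr hα).le h
  convert! h' using 1
  field_simp
  ring

/-- Stability of the modified Bassi–Rebay (BR2) SAT coefficients:
with `T₁ = (1/(2α_k))(c_k·w_k) + (1/(2α_v))(c_v·w_v)` the interface-penalty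
matrix is positive semidefinite. -/
theorem stmt7 (n : ℕ) (hn : 1 ≤ n)
    (Vk Vv : Matrix (Fin n) (Fin n) ℝ)
    (hVk : Vk.PosSemidef) (hVv : Vv.PosSemidef)
    (ck cv : Fin n → ℝ) (αk αv : ℝ) (hαk : 0 < αk) (hαv : 0 < αv)
    (wk wv : Fin n → ℝ) (hwk : Vk *ᵥ wk = ck) (hwv : Vv *ᵥ wv = cv)
    (T1 : ℝ) (hT1 : T1 = (1 / (2 * αk)) * (ck ⬝ᵥ wk) + (1 / (2 * αv)) * (cv ⬝ᵥ wv)) :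
    (Matrix.fromBlocks
      (!![2 * T1, -(2 * T1); -(2 * T1), 2 * T1])
      (Matrix.of fun (i : Fin 2) (j : Fin n ⊕ Fin n) => Sum.elim
        (fun a => (if i = 0 then -(1 : ℝ) else (1 : ℝ)) * ck a)
        (fun b => (if i = 0 then (1 : ℝ) else -(1 : ℝ)) * cv b) j)
      (Matrix.of fun (i : Fin n ⊕ Fin n) (j : Fin 2) => Sum.elim
        (fun a => (if j = 0 then -(1 : ℝ) else (1 : ℝ)) * ck a)
        (fun b => (if j = 0 then (1 : ℝ) else -(1 : ℝ)) * cv b) i)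
      (Matrix.fromBlocks (αk • Vk) 0 0 (αv • Vv))).PosSemidef := by
  refine .of_dotProduct_mulVec_nonneg ?_ fun x => ?_
  · refine IsHermitian.fromBlocks ?_ ?_ (IsHermitian.fromBlocks ?_ (by simp) ?_)
    · ext i j
      fin_cases i <;> fin_cases j <;> simp
    · ext i j
      rcases i with i | i <;> simp
    · exact (hVk.smul hαk.le).isHermitian
    · exact (hVv.smul hαv.le).isHermitian
  · obtain ⟨s, u, rfl⟩ : ∃ s u, x = Sum.elim s u := ⟨_, _, (Sum.elim_comp_inl_inr x).symm⟩
    obtain ⟨y, z, rfl⟩ : ∃ y z, u = Sum.elim y z := ⟨_, _, (Sum.elim_comp_inl_inr u).symm⟩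
    have hk := hVk.complete_square_nonneg hwk hαk (s 0 - s 1) y
    have hv := hVv.complete_square_nonneg hwv hαv (s 1 - s 0) z
    have h := add_nonneg hk hv
    have hT : 2 * T1 = (1 / αk) * (ck ⬝ᵥ wk) + (1 / αv) * (cv ⬝ᵥ wv) := by
      rw [hT1]
      field_simp
    rw [hT]
    convert! h using 1
    have hB : ∀ (a b : ℝ) (c p : Fin n → ℝ), ∑ i, p i * (a * c i * b) = a * b * (c ⬝ᵥ p) := by
      intro a b c p
      rw [dotProduct, Finset.mul_sum]
      exact Finset.sum_congr rfl fun i _ => by ring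
    have hC : ∀ (a : ℝ) (c p : Fin n → ℝ), ∑ i, a * c i * p i = a * (c ⬝ᵥ p) := by
      intro a c p
      rw [dotProduct, Finset.mul_sum]
      exact Finset.sum_congr rfl fun i _ => by ring
    simp only [star_trivial, fromBlocks_mulVec, Sum.elim_comp_inl, Sum.elim_comp_inr,
      sumElim_dotProduct_sumElim, dotProduct_add, zero_mulVec, add_zero, zero_add,
      smul_mulVec, dotProduct_smul, smul_eq_mul]
    simp only [mulVec, dotProduct, Fin.sum_univ_two, Fintype.sum_sum_type, of_apply, Sum.elim_inl,
      Sum.elim_inr, mul_add, Finset.sum_add_distrib, hB, hC]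
    simp
    ring
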